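/- arXiv:2510.04177 — 3 statements merged into one kernel-verified Lean document; each statement's English description precedes it below -/
import Mathlib

section
/- Let P ∈ ℂ[x_1,…,x_n] be a nonzero polynomial, let w ∈ (ℤ_{>0})^n, set d := d_w(P), let a ∈ (ℂ^*)^n, and fix i ∈ {1,…,n}. Then lim_{s→0, s≠0} s^{-(d - w_i)} · (∂P/∂x_i)(a_1 s^{w_1}, …, a_n s^{w_n}) = (∂(in_w(P))/∂x_i)(a_1, …, a_n). (This is the leading-term identity ∂P/∂x_i(ξ(s)) = ∂(in_w(P))/∂x_i(a)·s^{d−w_i} + higher order terms used in the proof of Proposition 3.1.) -/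
open MvPolynomial

/-- Substituting `xⱼ = aⱼ s^{wⱼ}` into a monomial scales its value at `a` by the power of `s`
given by its weighted degree. -/
lemma eval_mul_pow_monomial {σ R : Type*} [Fintype σ] [CommSemiring R] (w : σ → ℕ) (a : σ → R)
    (s : R) (m : σ →₀ ℕ) (c : R) :
    eval (fun j => a j * s ^ w j) (monomial m c) =
      eval a (monomial m c) * s ^ ∑ j, w j * m j := by
  simp only [eval_monomial]
  rw [Finsupp.prod_fintype _ _ (fun _ => pow_zero _), Finsupp.prod_fintype _ _ (fun _ => pow_zero _),
    mul_assoc, ← Finset.prod_pow_eq_pow_sum, ← Finset.prod_mul_distrib]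
  simp only [mul_pow, pow_mul]

/-- The analogue of `eval_mul_pow_monomial` for a partial derivative of a monomial, whose weighted
degree drops by `wᵢ`. -/
lemma eval_mul_pow_pderiv_monomial {σ K : Type*} [Fintype σ] [Field K] (w : σ → ℕ)
    (a : σ → K) (s : K) (i : σ) (m : σ →₀ ℕ) (c : K) :
    eval (fun j => a j * s ^ w j) (pderiv i (monomial m c)) =
      eval a (pderiv i (monomial m c)) * s ^ (((∑ j, w j * m j : ℕ) : ℤ) - (w i : ℤ)) := by
  classical
  rw [pderiv_monomial]
  rcases Nat.eq_zero_or_pos (m i) with hm | hm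
  · simp [hm]
  have hle : Finsupp.single i 1 ≤ m := Finsupp.single_le_iff.2 hm
  obtain ⟨m', rfl⟩ := exists_add_of_le hle
  have hsum : ∑ j, w j * (Finsupp.single i 1 + m' : σ →₀ ℕ) j = w i + ∑ j, w j * m' j := by
    simp [mul_add, Finset.sum_add_distrib, Finsupp.single_apply]
  rw [eval_mul_pow_monomial, add_tsub_cancel_left, hsum]
  push_cast
  rw [add_sub_cancel_left]
  norm_cast

/-- For a nonzero `P ∈ ℂ[x₁,…,xₙ]`, `w ∈ (ℤ_{>0})ⁿ`,
`d := d_w(P)`, `a ∈ (ℂ^*)ⁿ`, and `i ∈ {1,…,n}`: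
`lim_{s→0, s≠0} s^{-(d-wᵢ)} · (∂P/∂xᵢ)(a₁ s^{w₁}, …, aₙ s^{wₙ})
  = (∂(in_w P)/∂xᵢ)(a)`. -/
theorem initial_form_derivative_leading_term (n : ℕ)
    (P : MvPolynomial (Fin n) ℂ) (hP : P ≠ 0)
    (w : Fin n → ℕ) (hw : ∀ i, 0 < w i)
    (a : Fin n → ℂ) (ha : ∀ i, a i ≠ 0) (i : Fin n)
    (d : ℕ) (hd : IsLeast {k : ℕ | ∃ m ∈ P.support, k = ∑ j, w j * m j} d)
    (Pin : MvPolynomial (Fin n) ℂ)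
    (hPin : Pin = ∑ m ∈ P.support.filter (fun m => ∑ j, w j * m j = d),
      monomial m (coeff m P)) :
    Filter.Tendsto
      (fun s : ℂ => (eval (fun j => a j * s ^ w j) (pderiv i P)) / s ^ ((d : ℤ) - (w i : ℤ)))
      (nhdsWithin 0 {(0 : ℂ)}ᶜ)
      (nhds (eval a (pderiv i Pin))) := by
  have hlim : ∀ m ∈ P.support, Filter.Tendsto
      (fun s : ℂ => eval a (pderiv i (monomial m (coeff m P))) * s ^ (∑ j, w j * m j - d))
      (nhdsWithin 0 {(0 : ℂ)}ᶜ)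
      (nhds (if ∑ j, w j * m j = d then eval a (pderiv i (monomial m (coeff m P))) else 0)) := by
    intro m hm
    have hle : d ≤ ∑ j, w j * m j := hd.2 ⟨m, hm, rfl⟩
    refine Filter.Tendsto.mono_left ?_ nhdsWithin_le_nhds
    refine Continuous.tendsto' (by fun_prop) _ _ ?_
    split_ifs with h
    · simp [h]
    · rw [zero_pow (by omega), mul_zero]
  have hval : eval a (pderiv i Pin) = ∑ m ∈ P.support,
      if ∑ j, w j * m j = d then eval a (pderiv i (monomial m (coeff m P))) else 0 := by
    rw [hPin, map_sum, map_sum, Finset.sum_filter]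
  rw [hval]
  refine (tendsto_finsetSum _ hlim).congr' ?_
  filter_upwards [self_mem_nhdsWithin] with s hs
  have hs0 : s ≠ 0 := hs
  conv_rhs => rw [P.as_sum, map_sum, map_sum, Finset.sum_div]
  refine Finset.sum_congr rfl fun m hm => ?_
  have hle : d ≤ ∑ j, w j * m j := hd.2 ⟨m, hm, rfl⟩
  rw [eval_mul_pow_pderiv_monomial, mul_div_assoc, ← zpow_sub₀ hs0, sub_sub_sub_cancel_right,
    ← Nat.cast_sub hle, zpow_natCast]
end

section
/- Let P ∈ ℂ[x_1,…,x_n] be a nonzero polynomial, let a ∈ (ℂ^*)^n, let w ∈ (ℤ_{>0})^n, and let ξ : [0,ε) → ℂ^n (ε > 0) be a real-analytic curve such that for each i, ξ_i(s) = a_i s^{w_i} + o(s^{w_i}) as s → 0⁺ (i.e., a_i s^{w_i} is the leading term of the Taylor expansion of ξ_i). If P(ξ(s)) = 0 and (∂P/∂x_i)(ξ(s)) = 0 for every s ∈ (0,ε) and every i ∈ {1,…,n}, then in_w(P)(a) = 0 and (∂(in_w(P))/∂x_i)(a) = 0 for every i ∈ {1,…,n}; that is, a ∈ (ℂ^*)^n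 is a singular point of the hypersurface in_w(P)^{-1}(0). -/
open MvPolynomial

open Filter Topology in
/-- If a combination of monomials of weight at least `d` vanishes along a curve with leading
terms `aᵢ s ^ wᵢ`, then its weight-`d` part vanishes at `a`. -/
lemma sum_weight_eq_zero_of_curve {n : ℕ} {a : Fin n → ℂ} {w : Fin n → ℕ} {ξ : ℝ → Fin n → ℂ}
    (hlead : ∀ i, Tendsto (fun s : ℝ => ξ s i / (s : ℂ) ^ w i) (𝓝[>] 0) (𝓝 (a i)))
    {d : ℕ} (S : Finset (Fin n →₀ ℕ)) (c : (Fin n →₀ ℕ) → ℂ)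
    (hd : ∀ m ∈ S, d ≤ ∑ i, w i * m i)
    (hzero : ∀ᶠ s : ℝ in 𝓝[>] 0, ∑ m ∈ S, c m * ∏ i, ξ s i ^ m i = 0) :
    ∑ m ∈ S with ∑ i, w i * m i = d, c m * ∏ i, a i ^ m i = 0 := by
  have hs : Tendsto (fun s : ℝ => (s : ℂ)) (𝓝[>] 0) (𝓝 0) :=
    tendsto_nhdsWithin_of_tendsto_nhds (Complex.continuous_ofReal.tendsto' 0 0 (by simp))
  have hlim : Tendsto (fun s : ℝ => ∑ m ∈ S, c m * ((∏ i, (ξ s i / (s : ℂ) ^ w i) ^ m i) *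
      (s : ℂ) ^ ((∑ i, w i * m i) - d))) (𝓝[>] 0)
      (𝓝 (∑ m ∈ S, c m * ((∏ i, a i ^ m i) * (0 : ℂ) ^ ((∑ i, w i * m i) - d)))) :=
    tendsto_finsetSum _ fun m _ => ((tendsto_finsetProd _ fun i _ => (hlead i).pow (m i)).mul
      (hs.pow _)).const_mul _
  have hlim_zero : Tendsto (fun s : ℝ => ∑ m ∈ S, c m * ((∏ i, (ξ s i / (s : ℂ) ^ w i) ^ m i) *
      (s : ℂ) ^ ((∑ i, w i * m i) - d))) (𝓝[>] 0) (𝓝 0) := by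
    refine tendsto_const_nhds.congr' ?_
    filter_upwards [hzero, self_mem_nhdsWithin] with s h hpos
    have hne : (s : ℂ) ≠ 0 := by exact_mod_cast (ne_of_gt hpos)
    rw [← zero_div ((s : ℂ) ^ d), ← h, Finset.sum_div]
    refine Finset.sum_congr rfl fun m hm => ?_
    have hprod : ∏ i, (ξ s i / (s : ℂ) ^ w i) ^ m i
        = (∏ i, ξ s i ^ m i) / (s : ℂ) ^ (∑ i, w i * m i) := by
      simp only [div_pow, Finset.prod_div_distrib, ← pow_mul, Finset.prod_pow_eq_pow_sum]
    rw [hprod, pow_sub₀ _ hne (hd m hm)]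
    field_simp
  rw [← tendsto_nhds_unique hlim hlim_zero, Finset.sum_filter]
  refine Finset.sum_congr rfl fun m hm => ?_
  split_ifs with h
  · simp [h]
  · have := hd m hm
    rw [zero_pow (by omega)]
    simp

/-- The Euler-type formula for `xᵢ ∂/∂xᵢ` applied to a sum of monomials. -/
lemma mul_eval_pderiv_sum_monomial {n : ℕ} (S : Finset (Fin n →₀ ℕ)) (c : (Fin n →₀ ℕ) → ℂ)
    (x : Fin n → ℂ) (i : Fin n) :
    x i * eval x (pderiv i (∑ m ∈ S, monomial m (c m)))
      = ∑ m ∈ S, (m i * c m) * ∏ j, x j ^ m j := by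
  have h : x i * eval x (pderiv i (∑ m ∈ S, monomial m (c m)))
      = eval x (X i * pderiv i (∑ m ∈ S, monomial m (c m))) := by simp
  rw [h, map_sum, Finset.mul_sum, map_sum]
  refine Finset.sum_congr rfl fun m _ => ?_
  rw [X_mul_pderiv_monomial, map_nsmul, eval_monomial, Finsupp.prod_fintype _ _ (by simp)]
  simp [mul_assoc]

/-- Let `P ∈ ℂ[x₁,…,xₙ]` be nonzero, `a ∈ (ℂ^*)ⁿ`,
`w ∈ (ℤ_{>0})ⁿ`, and let `ξ : [0,ε) → ℂⁿ` be a real-analytic curve with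
`ξᵢ(s) = aᵢ s^{wᵢ} + o(s^{wᵢ})` as `s → 0⁺`.  If `P(ξ(s)) = 0` and
`(∂P/∂xᵢ)(ξ(s)) = 0` for all `s ∈ (0,ε)` and all `i`, then `in_w(P)(a) = 0` and
`(∂(in_w P)/∂xᵢ)(a) = 0` for all `i`; i.e. `a` is a singular point of
`in_w(P)⁻¹(0)`. -/
theorem curve_selection_initial_form_singular (n : ℕ)
    (P : MvPolynomial (Fin n) ℂ) (hP : P ≠ 0)
    (a : Fin n → ℂ) (ha : ∀ i, a i ≠ 0)
    (w : Fin n → ℕ) (hw : ∀ i, 0 < w i)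
    (ε : ℝ) (hε : 0 < ε) (ξ : ℝ → Fin n → ℂ)
    (hanalytic : ∀ i, AnalyticOnNhd ℝ (fun s => ξ s i) (Set.Ico 0 ε))
    (hlead : ∀ i, Filter.Tendsto (fun s : ℝ => ξ s i / (s : ℂ) ^ w i)
      (nhdsWithin 0 (Set.Ioi 0)) (nhds (a i)))
    (d : ℕ) (hd : IsLeast {k : ℕ | ∃ m ∈ P.support, k = ∑ i, w i * m i} d)
    (Pin : MvPolynomial (Fin n) ℂ)
    (hPin : Pin = ∑ m ∈ P.support.filter (fun m => ∑ i, w i * m i = d),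
      monomial m (coeff m P))
    (hzero : ∀ s ∈ Set.Ioo (0 : ℝ) ε, eval (ξ s) P = 0)
    (hcrit : ∀ s ∈ Set.Ioo (0 : ℝ) ε, ∀ i, eval (ξ s) (pderiv i P) = 0) :
    eval a Pin = 0 ∧ ∀ i, eval a (pderiv i Pin) = 0 := by
  have hwt : ∀ m ∈ P.support, d ≤ ∑ i, w i * m i := fun m hm => hd.2 ⟨m, hm, rfl⟩
  have hIoo : Set.Ioo 0 ε ∈ nhdsWithin (0 : ℝ) (Set.Ioi 0) := Ioo_mem_nhdsGT hε
  subst hPin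
  refine ⟨?_, fun i => ?_⟩
  · have h := sum_weight_eq_zero_of_curve hlead P.support (fun m => coeff m P) hwt (by
      filter_upwards [hIoo] with s hs
      rw [← eval_eq', hzero s hs])
    rw [map_sum, ← h]
    refine Finset.sum_congr rfl fun m _ => ?_
    rw [eval_monomial, Finsupp.prod_fintype _ _ (by simp)]
  · have h := sum_weight_eq_zero_of_curve hlead P.support (fun m => m i * coeff m P) hwt (by
      filter_upwards [hIoo] with s hs
      rw [← mul_eval_pderiv_sum_monomial, support_sum_monomial_coeff, hcrit s hs i, mul_zero])
    rw [← mul_eval_pderiv_sum_monomial] at h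
    exact (mul_eq_zero.mp h).resolve_left (ha i)
end

section
/- (Proposition: restrictions of non-degenerate functions are non-degenerate.) Suppose G ∈ ℂ[z_1,…,z_r] is non-degenerate on the toric variety determined by b_1,…,b_r. Let τ be a face of σ̌, let I := {i ∈ {1,…,r} : b_i ∈ τ}, and assume L^I_G ≠ 0 (I is a non-vanishing index set). Then the restriction of G to X(S_σ)^I is non-degenerate: for every w ∈ σ ∩ ℤ^n such that Δ_w(L^I_G) := {x ∈ Γ₊(L^I_G) : ⟨w,x⟩ = min_{y ∈ Γ₊(L^I_G)} ⟨w,y⟩} is a compact face of Γ₊(L^I_G), there is no ξ ∈ (ℂ^*)^n with in_w(L^I_G)(ξ) = 0 and (∂(in_w(L^I_G))/∂ξ_j)(ξ) = 0 for all j = 1,…,n. -/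
open MvPolynomial

/-- The dual cone `σ̌ ⊆ ℝⁿ`: the convex cone spanned by the generators
`b₁, …, b_r ∈ ℕⁿ` of the semigroup `S_σ = σ̌ ∩ ℤⁿ`. -/
def dualCone (n r : ℕ) (b : Fin r → Fin n → ℕ) : Set (Fin n → ℝ) :=
  {x | ∃ c : Fin r → ℝ, (∀ i, 0 ≤ c i) ∧ x = ∑ i, c i • (fun j => (b i j : ℝ))}

/-- The Newton polyhedron `Γ₊(Q) = conv(⋃_{m ∈ supp Q} (m + σ̌))` of a polynomial
`Q ∈ ℂ[ξ₁,…,ξₙ]`. -/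
def newtonPolyhedron (n r : ℕ) (b : Fin r → Fin n → ℕ)
    (Q : MvPolynomial (Fin n) ℂ) : Set (Fin n → ℝ) :=
  convexHull ℝ (⋃ m ∈ Q.support, (fun c => (fun j => (m j : ℝ)) + c) '' dualCone n r b)

/-- The initial form `in_w(Q)`: the sum of the terms of `Q` whose exponent `m`
satisfies `⟨w,m⟩ = min{⟨w,m'⟩ : m' ∈ supp Q}`. -/
noncomputable def initialForm (n : ℕ) (w : Fin n → ℤ)
    (Q : MvPolynomial (Fin n) ℂ) : MvPolynomial (Fin n) ℂ :=
  ∑ m ∈ Q.support.filter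
      (fun m => ∀ m' ∈ Q.support, (∑ j, w j * (m j : ℤ)) ≤ ∑ j, w j * (m' j : ℤ)),
    monomial m (coeff m Q)

open Classical in
/-- The torus pullback `L^I_G(ξ) := G(u)` where `uᵢ = ξ^{bᵢ}` for `i ∈ I` and
`uᵢ = 0` for `i ∉ I`. -/
noncomputable def torusPullback (n r : ℕ) (b : Fin r → Fin n → ℕ) (I : Set (Fin r))
    (G : MvPolynomial (Fin r) ℂ) : MvPolynomial (Fin n) ℂ :=
  aeval (fun i : Fin r =>
    if i ∈ I then ∏ j, (X j : MvPolynomial (Fin n) ℂ) ^ b i j else 0) G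

/-- `Δ_w(Q) = {x ∈ Γ₊(Q) : ⟨w,x⟩ = min_{y ∈ Γ₊(Q)} ⟨w,y⟩}` is a (nonempty)
compact face of `Γ₊(Q)`. -/
def HasCompactFace (n r : ℕ) (b : Fin r → Fin n → ℕ) (w : Fin n → ℤ)
    (Q : MvPolynomial (Fin n) ℂ) : Prop :=
  {x ∈ newtonPolyhedron n r b Q | ∑ j, (w j : ℝ) * x j =
      sInf ((fun x => ∑ j, (w j : ℝ) * x j) '' newtonPolyhedron n r b Q)}.Nonempty ∧
  IsCompact {x ∈ newtonPolyhedron n r b Q | ∑ j, (w j : ℝ) * x j =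
      sInf ((fun x => ∑ j, (w j : ℝ) * x j) '' newtonPolyhedron n r b Q)}

/-- `Q ∈ ℂ[ξ₁,…,ξₙ]` is non-degenerate: for every weight `w ∈ σ ∩ ℤⁿ` (i.e.
pairing nonnegatively with every `bᵢ`) such that `Δ_w` is a compact face of
`Γ₊(Q)`, there is no `ξ ∈ (ℂ^*)ⁿ` with `in_w(Q)(ξ) = 0` at which all partial
derivatives of `in_w(Q)` vanish. -/
def NonDegenerate (n r : ℕ) (b : Fin r → Fin n → ℕ)
    (Q : MvPolynomial (Fin n) ℂ) : Prop :=
  ∀ w : Fin n → ℤ, (∀ i, 0 ≤ ∑ j, w j * (b i j : ℤ)) →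
    HasCompactFace n r b w Q →
    ¬ ∃ ξ : Fin n → ℂ, (∀ j, ξ j ≠ 0) ∧ eval ξ (initialForm n w Q) = 0 ∧
        ∀ j, eval ξ (pderiv j (initialForm n w Q)) = 0

/-- A real functional can be replaced by an integral one having the same signs on finitely many
integral vectors on which it is nonnegative. -/
lemma exists_integral_functional {n r : ℕ} (b : Fin r → Fin n → ℕ) (u : Fin n → ℝ)
    (hu : ∀ i, 0 ≤ ∑ j, u j * (b i j : ℝ)) :
    ∃ v : Fin n → ℤ, ∀ i,
      (∑ j, u j * (b i j : ℝ) = 0 → ∑ j, v j * (b i j : ℤ) = 0) ∧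
      (∑ j, u j * (b i j : ℝ) ≠ 0 → 0 < ∑ j, v j * (b i j : ℤ)) := by
  classical
  let B := Module.Basis.ofVectorSpace ℚ ℝ
  let F : (Module.Basis.ofVectorSpaceIndex ℚ ℝ → ℝ) → ℝ → ℝ :=
    fun e x => (B.repr x).sum fun k q => (q : ℝ) * e k
  have hF : ∀ x, Continuous fun e => F e x := fun x => by
    simp only [F, Finsupp.sum]
    fun_prop
  have hFB : ∀ x, F (fun k => B k) x = x := fun x => by
    conv_rhs => rw [← B.linearCombination_repr x, Finsupp.linearCombination_apply]
    simp only [F, Rat.smul_def]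
  let pos : Finset (Fin r) := {i | ∑ j, u j * (b i j : ℝ) ≠ 0}
  have hopen : IsOpen {e | ∀ i ∈ pos, 0 < F e (∑ j, u j * (b i j : ℝ))} := by
    simp only [Set.ofPred_forall]
    exact isOpen_biInter_finset fun i _ => isOpen_lt continuous_const (hF _)
  have hdense : DenseRange (Pi.map fun (_ : Module.Basis.ofVectorSpaceIndex ℚ ℝ) (q : ℚ) =>
      (q : ℝ)) := DenseRange.piMap fun _ => Rat.denseRange_cast
  obtain ⟨e, he⟩ := hdense.exists_mem_open hopen ⟨fun k => B k, fun i hi => by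
    rw [hFB]
    exact lt_of_le_of_ne (hu i) (Ne.symm (Finset.mem_filter.1 hi).2)⟩
  let φ : ℝ →ₗ[ℚ] ℚ := B.constr ℚ e
  have hφF : ∀ x, ((φ x : ℚ) : ℝ) = F (Pi.map (fun _ (q : ℚ) => (q : ℝ)) e) x := fun x => by
    simp only [φ, F, Module.Basis.constr_apply, Finsupp.sum, Pi.map_apply, smul_eq_mul]
    push_cast
    rfl
  have hφ : ∀ i, φ (∑ j, u j * (b i j : ℝ)) = ∑ j, φ (u j) * (b i j : ℚ) := fun i => by
    rw [map_sum]
    refine Finset.sum_congr rfl fun j _ => ?_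
    rw [mul_comm, ← nsmul_eq_mul, map_nsmul, nsmul_eq_mul, mul_comm]
  let D : ℕ := ∏ j, (φ (u j)).den
  have hD : 0 < D := Finset.prod_pos fun j _ => (φ (u j)).den_pos
  have hint : ∀ j, ∃ z : ℤ, (z : ℚ) = D * φ (u j) := fun j => by
    obtain ⟨k, hk⟩ := Finset.dvd_prod_of_mem (fun j => (φ (u j)).den) (Finset.mem_univ j)
    refine ⟨k * (φ (u j)).num, ?_⟩
    have hk' : D = (φ (u j)).den * k := hk
    rw [hk']
    push_cast
    rw [← Rat.den_mul_eq_num (φ (u j))]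
    ring
  choose v hv using hint
  have hvφ : ∀ i, ((∑ j, v j * (b i j : ℤ) : ℤ) : ℚ) = D * φ (∑ j, u j * (b i j : ℝ)) :=
    fun i => by
      rw [hφ, Finset.mul_sum]
      push_cast
      exact Finset.sum_congr rfl fun j _ => by rw [hv, mul_assoc]
  refine ⟨v, fun i => ⟨fun h => ?_, fun h => ?_⟩⟩
  · have := hvφ i
    rw [h, map_zero, mul_zero] at this
    exact_mod_cast this
  · have h1 : 0 < F (Pi.map (fun _ (q : ℚ) => (q : ℝ)) e) (∑ j, u j * (b i j : ℝ)) :=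
      he i (Finset.mem_filter.2 ⟨Finset.mem_univ _, h⟩)
    rw [← hφF] at h1
    have h2 : 0 < φ (∑ j, u j * (b i j : ℝ)) := by exact_mod_cast h1
    have h3 : (0 : ℚ) < ((∑ j, v j * (b i j : ℤ) : ℤ) : ℚ) := by
      rw [hvφ]
      positivity
    exact_mod_cast h3

/-- The exponent `∑ aᵢ bᵢ` of the pullback of the monomial `z^a`. -/
noncomputable def pullbackExponent {n r : ℕ} (b : Fin r → Fin n → ℕ) (a : Fin r →₀ ℕ) :
    Fin n →₀ ℕ :=
  ∑ i, a i • Finsupp.equivFunOnFinite.symm (b i)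

lemma pairing_pullbackExponent {n r : ℕ} (b : Fin r → Fin n → ℕ) (a : Fin r →₀ ℕ)
    (w : Fin n → ℤ) :
    ∑ j, w j * (pullbackExponent b a j : ℤ) = ∑ i, (a i : ℤ) * ∑ j, w j * (b i j : ℤ) := by
  simp only [pullbackExponent, Finsupp.finsetSum_apply, Finsupp.smul_apply, smul_eq_mul,
    Finsupp.equivFunOnFinite_symm_apply_apply]
  push_cast
  simp only [Finset.mul_sum]
  rw [Finset.sum_comm]
  exact Finset.sum_congr rfl fun i _ => Finset.sum_congr rfl fun j _ => by ring

lemma prod_X_pow_eq_monomial_symm {n : ℕ} (c : Fin n → ℕ) :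
    ∏ j, (X j : MvPolynomial (Fin n) ℂ) ^ c j =
      monomial (Finsupp.equivFunOnFinite.symm c) 1 := by
  rw [monomial_eq, C_1, one_mul, Finsupp.prod_fintype _ _ (by simp)]
  simp

open Classical in
lemma torusPullback_monomial {n r : ℕ} (b : Fin r → Fin n → ℕ) (I : Set (Fin r))
    (a : Fin r →₀ ℕ) (c : ℂ) :
    torusPullback n r b I (monomial a c) =
      if ∀ i, a i ≠ 0 → i ∈ I then monomial (pullbackExponent b a) c else 0 := by
  rw [torusPullback, aeval_monomial, Finsupp.prod_fintype _ _ (by simp), algebraMap_eq]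
  split_ifs with h
  · have : ∀ i, (if i ∈ I then ∏ j, (X j : MvPolynomial (Fin n) ℂ) ^ b i j else 0) ^ a i =
        monomial (a i • Finsupp.equivFunOnFinite.symm (b i)) 1 := fun i => by
      by_cases hi : a i = 0
      · simp [hi]
      · rw [if_pos (h i hi), prod_X_pow_eq_monomial_symm, monomial_pow, one_pow]
    simp only [this]
    rw [← monomial_sum_one, C_mul_monomial, mul_one, pullbackExponent]
  · push Not at h
    obtain ⟨i, hi, hiI⟩ := h
    rw [Finset.prod_eq_zero (Finset.mem_univ i), mul_zero]
    rw [if_neg hiI, zero_pow hi]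

lemma torusPullback_add {n r : ℕ} (b : Fin r → Fin n → ℕ) (I : Set (Fin r))
    (G H : MvPolynomial (Fin r) ℂ) :
    torusPullback n r b I (G + H) = torusPullback n r b I G + torusPullback n r b I H :=
  map_add _ _ _

lemma exists_pullbackExponent_of_mem_support {n r : ℕ} (b : Fin r → Fin n → ℕ)
    (G : MvPolynomial (Fin r) ℂ) {m : Fin n →₀ ℕ}
    (hm : m ∈ (torusPullback n r b Set.univ G).support) :
    ∃ a, m = pullbackExponent b a := by
  classical
  by_contra! h
  refine mem_support_iff.1 hm ?_
  clear hm
  induction G using MvPolynomial.induction_on' with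
  | monomial a c =>
    rw [torusPullback_monomial, if_pos fun _ _ => Set.mem_univ _, coeff_monomial,
      if_neg (h a).symm]
  | add G H hG hH => rw [torusPullback_add, coeff_add, hG, hH, add_zero]

lemma pairing_nonneg_of_mem_support {n r : ℕ} (b : Fin r → Fin n → ℕ) (w : Fin n → ℤ)
    (hw : ∀ i, 0 ≤ ∑ j, w j * (b i j : ℤ)) (G : MvPolynomial (Fin r) ℂ) {m : Fin n →₀ ℕ}
    (hm : m ∈ (torusPullback n r b Set.univ G).support) :
    0 ≤ ∑ j, w j * (m j : ℤ) := by
  obtain ⟨a, rfl⟩ := exists_pullbackExponent_of_mem_support b G hm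
  rw [pairing_pullbackExponent]
  exact Finset.sum_nonneg fun i _ => mul_nonneg (Int.natCast_nonneg _) (hw i)

/-- Restricting to the face cut out by `v` keeps exactly the terms on which `v` vanishes. -/
lemma coeff_torusPullback_face {n r : ℕ} (b : Fin r → Fin n → ℕ) (v : Fin n → ℤ)
    (hv : ∀ i, 0 ≤ ∑ j, v j * (b i j : ℤ)) (G : MvPolynomial (Fin r) ℂ) (m : Fin n →₀ ℕ) :
    coeff m (torusPullback n r b {i | ∑ j, v j * (b i j : ℤ) = 0} G) =
      if ∑ j, v j * (m j : ℤ) = 0 then coeff m (torusPullback n r b Set.univ G) else 0 := by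
  classical
  induction G using MvPolynomial.induction_on' with
  | monomial a c =>
    have key : (∀ i, a i ≠ 0 → i ∈ {i | ∑ j, v j * (b i j : ℤ) = 0}) ↔
        ∑ j, v j * (pullbackExponent b a j : ℤ) = 0 := by
      rw [pairing_pullbackExponent, Finset.sum_eq_zero_iff_of_nonneg
        fun i _ => mul_nonneg (Int.natCast_nonneg _) (hv i)]
      simp only [Finset.mem_univ, true_imp_iff, mul_eq_zero, Nat.cast_eq_zero, Set.mem_ofPred_eq,
        or_iff_not_imp_left, ne_eq]
    rw [torusPullback_monomial, torusPullback_monomial, if_pos fun _ _ => Set.mem_univ _]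
    simp only [key, coeff_monomial]
    by_cases h : pullbackExponent b a = m
    · subst h
      by_cases h' : ∑ j, v j * (pullbackExponent b a j : ℤ) = 0 <;> simp [h']
    · split_ifs <;> simp [coeff_monomial, h]
  | add G H hG hH =>
    simp only [torusPullback_add, coeff_add, hG, hH]
    split_ifs <;> simp

lemma add_mem_newtonPolyhedron {n r : ℕ} {b : Fin r → Fin n → ℕ}
    {Q : MvPolynomial (Fin n) ℂ} {x c : Fin n → ℝ} (hx : x ∈ newtonPolyhedron n r b Q)
    (hc : c ∈ dualCone n r b) : x + c ∈ newtonPolyhedron n r b Q := by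
  have hconv : Convex ℝ {x | x + c ∈ newtonPolyhedron n r b Q} :=
    (convex_convexHull ℝ _).translate_preimage_left c
  refine convexHull_min (fun y hy => ?_) hconv hx
  simp only [Set.mem_iUnion, Set.mem_image] at hy
  obtain ⟨m, hm, _, ⟨d, hd, rfl⟩, rfl⟩ := hy
  obtain ⟨e, he, rfl⟩ := hc
  refine subset_convexHull ℝ _ ?_
  simp only [Set.mem_iUnion, Set.mem_image]
  refine ⟨m, hm, _, ⟨d + e, fun i => add_nonneg (hd i) (he i), rfl⟩, ?_⟩
  simp only [Pi.add_apply, add_smul, Finset.sum_add_distrib, add_assoc]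

lemma smul_generator_mem_dualCone {n r : ℕ} (b : Fin r → Fin n → ℕ) (i : Fin r) {t : ℝ}
    (ht : 0 ≤ t) : t • (fun j => (b i j : ℝ)) ∈ dualCone n r b := by
  classical
  refine ⟨Pi.single i t, fun k => ?_, ?_⟩
  · by_cases h : k = i
    · subst h; simpa using ht
    · simp [h]
  · rw [Finset.sum_eq_single i]
    · simp
    · intro k _ hk
      simp [hk]
    · simp

/-- A weight with a compact face is strictly positive on the generators. -/
lemma pairing_pos_of_hasCompactFace {n r : ℕ} {b : Fin r → Fin n → ℕ} (hb : ∀ i, b i ≠ 0)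
    {w : Fin n → ℤ} (hw : ∀ i, 0 ≤ ∑ j, w j * (b i j : ℤ)) {Q : MvPolynomial (Fin n) ℂ}
    (h : HasCompactFace n r b w Q) (i : Fin r) : 0 < ∑ j, w j * (b i j : ℤ) := by
  refine lt_of_le_of_ne (hw i) fun h0 => ?_
  obtain ⟨⟨x, hx, hxmin⟩, hcomp⟩ := h
  obtain ⟨j, hj⟩ := Function.ne_iff.1 (hb i)
  have hj1 : (1 : ℝ) ≤ b i j := by exact_mod_cast Nat.one_le_iff_ne_zero.2 hj
  obtain ⟨M, hM⟩ := hcomp.bddAbove_image (f := fun x => x j) (continuous_apply j).continuousOn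
  have h0' : ∑ k, (w k : ℝ) * (b i k : ℝ) = 0 := by exact_mod_cast h0.symm
  have hmem : ∀ t : ℝ, 0 ≤ t → x j + t * b i j ≤ M := fun t ht => by
    refine hM ⟨x + t • (fun k => (b i k : ℝ)),
      ⟨add_mem_newtonPolyhedron hx (smul_generator_mem_dualCone b i ht), ?_⟩, rfl⟩
    rw [← hxmin]
    have : ∑ k, (w k : ℝ) * (t * (b i k : ℝ)) = 0 := by
      rw [← mul_zero t, ← h0', Finset.mul_sum]
      exact Finset.sum_congr rfl fun k _ => by ring
    simp only [Pi.add_apply, Pi.smul_apply, smul_eq_mul, mul_add, Finset.sum_add_distrib, this,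
      add_zero]
  have h1 := hmem (|M - x j| + 1) (by positivity)
  have h2 := le_abs_self (M - x j)
  nlinarith [abs_nonneg (M - x j)]

/-- A weight that is strictly positive on the generators has a compact face. -/
lemma hasCompactFace_of_pairing_pos {n r : ℕ} {b : Fin r → Fin n → ℕ} {w : Fin n → ℤ}
    (hw : ∀ i, 0 < ∑ j, w j * (b i j : ℤ)) {Q : MvPolynomial (Fin n) ℂ} (hQ : Q ≠ 0) :
    HasCompactFace n r b w Q := by
  let ℓ : (Fin n → ℝ) →ₗ[ℝ] ℝ := ∑ j, (w j : ℝ) • LinearMap.proj j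
  have hℓ : ∀ x, ∑ j, (w j : ℝ) * x j = ℓ x := fun x => by simp [ℓ]
  let ι : (Fin n →₀ ℕ) → Fin n → ℝ := fun m j => (m j : ℝ)
  obtain ⟨m₀, hm₀, hmin⟩ := Q.support.exists_min_image (fun m => ℓ (ι m))
    (support_nonempty.2 hQ)
  set μ := ℓ (ι m₀)
  let K := convexHull ℝ (ι '' {m | m ∈ Q.support ∧ ℓ (ι m) = μ})
  have hKℓ : ∀ x ∈ K, ℓ x = μ := fun x hx => by
    refine convexHull_min (t := {x | ℓ x = μ}) ?_ (convex_hyperplane ℓ.isLinear μ) hx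
    rintro _ ⟨m, hm, rfl⟩
    exact hm.2
  have hKcompact : IsCompact K :=
    ((Q.support.finite_toSet.subset (t := {m | m ∈ Q.support ∧ ℓ (ι m) = μ})
      fun m hm => hm.1).image ι).isCompact_convexHull ℝ
  have hcone0 : (0 : Fin n → ℝ) ∈ dualCone n r b := ⟨0, fun _ => le_rfl, by simp⟩
  have hK : K ⊆ newtonPolyhedron n r b Q := by
    refine convexHull_mono ?_
    rintro _ ⟨m, hm, rfl⟩
    simp only [Set.mem_iUnion]
    exact ⟨m, hm.1, 0, hcone0, add_zero _⟩
  have hwR : ∀ i, 0 < ℓ (fun j => (b i j : ℝ)) := fun i => by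
    rw [← hℓ]
    exact_mod_cast hw i
  have hconv : Convex ℝ ({x | μ < ℓ x} ∪ K) := by
    have hle : ∀ x ∈ {x | μ < ℓ x} ∪ K, μ ≤ ℓ x := fun x hx =>
      hx.elim (fun h => le_of_lt h) fun h => (hKℓ x h).ge
    refine convex_iff_forall_pos.2 fun x hx y hy s t hs ht hst => ?_
    have hsum : ℓ (s • x + t • y) = s * ℓ x + t * ℓ y := by simp
    have hμ : μ = s * μ + t * μ := by rw [← add_mul, hst, one_mul]
    have hxμ := hle x hx
    have hyμ := hle y hy
    rcases hx with hx | hx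
    · left
      have hx' : μ < ℓ x := hx
      change μ < ℓ (s • x + t • y)
      rw [hsum]
      nlinarith [mul_lt_mul_of_pos_left hx' hs, mul_le_mul_of_nonneg_left hyμ ht.le]
    · rcases hy with hy | hy
      · left
        have hy' : μ < ℓ y := hy
        change μ < ℓ (s • x + t • y)
        rw [hsum]
        nlinarith [mul_lt_mul_of_pos_left hy' ht, mul_le_mul_of_nonneg_left hxμ hs.le]
      · right
        exact convex_convexHull ℝ _ hx hy hs.le ht.le hst
  have hsub : newtonPolyhedron n r b Q ⊆ {x | μ < ℓ x} ∪ K := by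
    refine convexHull_min (fun y hy => ?_) hconv
    simp only [Set.mem_iUnion, Set.mem_image] at hy
    obtain ⟨m, hm, _, ⟨d, hd, rfl⟩, rfl⟩ := hy
    have hmμ : μ ≤ ℓ (ι m) := hmin m hm
    change ι m + _ ∈ _
    by_cases hd0 : ∀ i, d i = 0
    · simp only [hd0, zero_smul, Finset.sum_const_zero, add_zero]
      rcases hmμ.lt_or_eq with h | h
      · exact Or.inl h
      · exact Or.inr (subset_convexHull ℝ _ ⟨m, ⟨hm, h.symm⟩, rfl⟩)
    · left
      push Not at hd0
      obtain ⟨i, hi⟩ := hd0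
      have : 0 < ∑ i, d i * ℓ (fun j => (b i j : ℝ)) :=
        Finset.sum_pos' (fun k _ => mul_nonneg (hd k) (hwR k).le)
          ⟨i, Finset.mem_univ i, mul_pos (lt_of_le_of_ne (hd i) (Ne.symm hi)) (hwR i)⟩
      simp only [Set.mem_ofPred_eq, map_add, map_sum, map_smul, smul_eq_mul]
      linarith
  have hm₀K : ι m₀ ∈ K := subset_convexHull ℝ _ ⟨m₀, ⟨hm₀, rfl⟩, rfl⟩
  have hinf : sInf (ℓ '' newtonPolyhedron n r b Q) = μ := by
    refine IsLeast.csInf_eq ⟨⟨ι m₀, hK hm₀K, rfl⟩, ?_⟩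
    rintro _ ⟨x, hx, rfl⟩
    exact (hsub hx).elim (fun h => le_of_lt h) fun h => (hKℓ x h).ge
  have hfaceK : {x ∈ newtonPolyhedron n r b Q | ℓ x = μ} = K := by
    ext x
    refine ⟨fun hx => (hsub hx.1).resolve_left fun h => ?_, fun hx => ⟨hK hx, hKℓ x hx⟩⟩
    exact (ne_of_gt h) hx.2
  simp only [HasCompactFace, hℓ]
  rw [show (fun x => ℓ x) = ⇑ℓ from rfl, hinf, hfaceK]
  exact ⟨⟨_, hm₀K⟩, hKcompact⟩

/-- If `G ∈ ℂ[z₁,…,z_r]` is non-degenerate on the toric variety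
determined by `b₁,…,b_r`, and `τ` is a face of `σ̌` with
`I := {i : bᵢ ∈ τ}` (so `I = {i : ⟨u,bᵢ⟩ = 0}` for some `u ∈ σ`) such that
`L^I_G ≠ 0`, then the restriction of `G` to `X(S_σ)^I` is non-degenerate, i.e.
`L^I_G` is non-degenerate. -/
theorem restriction_nondegenerate (n r : ℕ)
    (b : Fin r → Fin n → ℕ) (hb : ∀ i, b i ≠ 0)
    (hpointed : ∀ x ∈ dualCone n r b, -x ∈ dualCone n r b → x = 0)
    (G : MvPolynomial (Fin r) ℂ)
    (hG : NonDegenerate n r b (torusPullback n r b Set.univ G))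
    (I : Set (Fin r))
    (hface : ∃ u : Fin n → ℝ, (∀ i, 0 ≤ ∑ j, u j * (b i j : ℝ)) ∧
      I = {i | ∑ j, u j * (b i j : ℝ) = 0})
    (hLI : torusPullback n r b I G ≠ 0) :
    NonDegenerate n r b (torusPullback n r b I G) := by
  obtain ⟨u, hu, rfl⟩ := hface
  obtain ⟨v, hv⟩ := exists_integral_functional b u hu
  have hv0 : ∀ i, 0 ≤ ∑ j, v j * (b i j : ℤ) := fun i => by
    by_cases h : ∑ j, u j * (b i j : ℝ) = 0
    · exact ((hv i).1 h).ge
    · exact ((hv i).2 h).le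
  have hI : {i | ∑ j, u j * (b i j : ℝ) = 0} = {i | ∑ j, v j * (b i j : ℤ) = 0} := by
    ext i
    exact ⟨(hv i).1, fun h => by_contra fun h' => ((hv i).2 h').ne' h⟩
  rw [hI] at hLI ⊢
  have hcoeff := coeff_torusPullback_face b v hv0 G
  set P := torusPullback n r b {i | ∑ j, v j * (b i j : ℤ) = 0} G
  have hnonneg : ∀ w : Fin n → ℤ, (∀ i, 0 ≤ ∑ j, w j * (b i j : ℤ)) →
      ∀ m ∈ (torusPullback n r b Set.univ G).support, 0 ≤ ∑ j, w j * (m j : ℤ) :=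
    fun w hw m hm => pairing_nonneg_of_mem_support b w hw G hm
  set Q := torusPullback n r b Set.univ G
  have hsupp : ∀ m, m ∈ P.support ↔ m ∈ Q.support ∧ ∑ j, v j * (m j : ℤ) = 0 := fun m => by
    rw [mem_support_iff, mem_support_iff, hcoeff]
    split_ifs with h <;> simp [h]
  intro w hw hface
  have hwpos := pairing_pos_of_hasCompactFace hb hw hface
  obtain ⟨m₀, hm₀, hmin⟩ := P.support.exists_min_image (fun m => ∑ j, w j * (m j : ℤ))
    (support_nonempty.2 hLI)
  have hm₀Q := (hsupp m₀).1 hm₀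
  set N : ℤ := ∑ j, w j * (m₀ j : ℤ) + 1
  have hN : 0 < N := by linarith [hnonneg w hw m₀ hm₀Q.1]
  have hpair : ∀ c : Fin n → ℕ, ∑ j, (w + N • v) j * (c j : ℤ) =
      ∑ j, w j * (c j : ℤ) + N * ∑ j, v j * (c j : ℤ) := fun c => by
    simp only [Pi.add_apply, Pi.smul_apply, smul_eq_mul, add_mul, Finset.sum_add_distrib,
      Finset.mul_sum, mul_assoc]
  have hpos : ∀ i, 0 < ∑ j, (w + N • v) j * (b i j : ℤ) := fun i => by
    rw [hpair]
    exact add_pos_of_pos_of_nonneg (hwpos i) (mul_nonneg hN.le (hv0 i))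
  have hQ : Q ≠ 0 := support_nonempty.1 ⟨m₀, hm₀Q.1⟩
  have hin : initialForm n w P = initialForm n (w + N • v) Q := by
    have hlow : ∀ m ∈ Q.support, ∑ j, w j * (m₀ j : ℤ) ≤ ∑ j, (w + N • v) j * (m j : ℤ) ∧
        (∑ j, (w + N • v) j * (m j : ℤ) ≤ ∑ j, w j * (m₀ j : ℤ) →
          ∑ j, v j * (m j : ℤ) = 0) := fun m hm => by
      rw [hpair]
      by_cases h : ∑ j, v j * (m j : ℤ) = 0
      · rw [h, mul_zero, add_zero]
        exact ⟨hmin m ((hsupp m).2 ⟨hm, h⟩), fun _ => rfl⟩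
      · have h1 : 1 ≤ ∑ j, v j * (m j : ℤ) := lt_of_le_of_ne (hnonneg v hv0 m hm) (Ne.symm h)
        have h2 : N ≤ N * ∑ j, v j * (m j : ℤ) := le_mul_of_one_le_right hN.le h1
        have h3 := hnonneg w hw m hm
        exact ⟨by linarith, fun h4 => by linarith⟩
    have hm₀pair : ∑ j, (w + N • v) j * (m₀ j : ℤ) = ∑ j, w j * (m₀ j : ℤ) := by
      rw [hpair, hm₀Q.2, mul_zero, add_zero]
    unfold initialForm
    refine Finset.sum_congr (Finset.ext fun m => ?_) fun m hm => ?_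
    · rw [Finset.mem_filter, Finset.mem_filter]
      constructor
      · rintro ⟨hm, hmle⟩
        obtain ⟨hmQ, hmv⟩ := (hsupp m).1 hm
        refine ⟨hmQ, fun m' hm' => le_trans ?_ (hlow m' hm').1⟩
        rw [hpair, hmv, mul_zero, add_zero]
        exact hmle m₀ hm₀
      · rintro ⟨hm, hmle⟩
        have hm0 := hmle m₀ hm₀Q.1
        rw [hm₀pair] at hm0
        have hmv := (hlow m hm).2 hm0
        rw [hpair, hmv, mul_zero, add_zero] at hm0
        exact ⟨(hsupp m).2 ⟨hm, hmv⟩, fun m' hm' => hm0.trans (hmin m' hm')⟩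
    · rw [Finset.mem_filter] at hm
      have hm0 := hm.2 m₀ hm₀Q.1
      rw [hm₀pair] at hm0
      rw [hcoeff, if_pos ((hlow m hm.1).2 hm0)]
  rw [hin]
  exact hG (w + N • v) (fun i => (hpos i).le) (hasCompactFace_of_pairing_pos hpos hQ)
end
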